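/- Let 0 < r < R, let ρ(x,y,z) = √((√(x² + y²) − R)² + z²) − r be the signed distance function of the torus 𝒯 = {ρ = 0}, and let Ω = {x² + y² > 0 and (√(x² + y²) − R)² + z² > 0}. Define the closest point projection π : Ω → ℝ³ by π(p) = p − ρ(p)·∇ρ(p). Then for every p ∈ Ω: (i) π(p) ∈ 𝒯, i.e., ρ(π(p)) = 0; (ii) ‖p − π(p)‖ = |ρ(p)| = dist(p, 𝒯), so π(p) is a nearest point of 𝒯 to p; and (iii) π(π(p)) = π(p). -/

import Mathlib

/-- The signed distance function `ρ(x,y,z) = √((√(x² + y²) − R)² + z²) − r` of the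
torus with radii `r < R`. -/
noncomputable def torusSD (R r : ℝ) (p : EuclideanSpace ℝ (Fin 3)) : ℝ :=
  Real.sqrt ((Real.sqrt ((p 0) ^ 2 + (p 1) ^ 2) - R) ^ 2 + (p 2) ^ 2) - r

/-- The open set `Ω = {x² + y² > 0 and (√(x² + y²) − R)² + z² > 0}`, the complement of
the z-axis and of the core circle. -/
def torusDom (R : ℝ) : Set (EuclideanSpace ℝ (Fin 3)) :=
  {p | 0 < (p 0) ^ 2 + (p 1) ^ 2 ∧
       0 < (Real.sqrt ((p 0) ^ 2 + (p 1) ^ 2) - R) ^ 2 + (p 2) ^ 2}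

/-- The closest point projection `π(p) = p − ρ(p)·∇ρ(p)`. -/
noncomputable def cpProj (R r : ℝ) (p : EuclideanSpace ℝ (Fin 3)) :
    EuclideanSpace ℝ (Fin 3) :=
  p - torusSD R r p • gradient (torusSD R r) p

/-- The Euclidean norm on the plane is 1-Lipschitz, in coordinates. -/
lemma sqrt_sq_add_sq_sub_sq_le (a b c d : ℝ) :
    (Real.sqrt (a ^ 2 + b ^ 2) - Real.sqrt (c ^ 2 + d ^ 2)) ^ 2 ≤ (a - c) ^ 2 + (b - d) ^ 2 := by
  have h : a * c + b * d ≤ Real.sqrt (a ^ 2 + b ^ 2) * Real.sqrt (c ^ 2 + d ^ 2) := by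
    rw [← Real.sqrt_mul (by positivity)]
    apply Real.le_sqrt_of_sq_le
    nlinarith [sq_nonneg (a * d - b * c)]
  nlinarith [Real.sq_sqrt (show 0 ≤ a ^ 2 + b ^ 2 by positivity),
    Real.sq_sqrt (show 0 ≤ c ^ 2 + d ^ 2 by positivity)]

lemma abs_torusSD_sub_le_dist (R r : ℝ) (p q : EuclideanSpace ℝ (Fin 3)) :
    |torusSD R r p - torusSD R r q| ≤ dist p q := by
  rw [EuclideanSpace.dist_eq, Fin.sum_univ_three]
  apply Real.abs_le_sqrt
  have h₁ := sqrt_sq_add_sq_sub_sq_le (Real.sqrt (p 0 ^ 2 + p 1 ^ 2) - R) (p 2)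
    (Real.sqrt (q 0 ^ 2 + q 1 ^ 2) - R) (q 2)
  have h₂ := sqrt_sq_add_sq_sub_sq_le (p 0) (p 1) (q 0) (q 1)
  simp only [torusSD, Real.dist_eq, sq_abs, sub_sub_sub_cancel_right] at h₁ ⊢
  linarith

lemma hasGradientAt_torusSD (R r : ℝ) {p : EuclideanSpace ℝ (Fin 3)} (hp : p ∈ torusDom R)
    {s d : ℝ} (hs : s = Real.sqrt (p 0 ^ 2 + p 1 ^ 2))
    (hd : d = Real.sqrt ((s - R) ^ 2 + p 2 ^ 2)) :
    HasGradientAt (torusSD R r)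
      !₂[p 0 / s * ((s - R) / d), p 1 / s * ((s - R) / d), p 2 / d] p := by
  obtain ⟨h₁, h₂⟩ := hp
  have hs0 : 0 < s := hs ▸ Real.sqrt_pos.2 h₁
  have hd0 : 0 < d := by rw [hd, hs]; exact Real.sqrt_pos.2 h₂
  have hc (i : Fin 3) : HasFDerivAt (fun q : EuclideanSpace ℝ (Fin 3) => q i)
      (EuclideanSpace.proj i : EuclideanSpace ℝ (Fin 3) →L[ℝ] ℝ) p :=
    (EuclideanSpace.proj i : EuclideanSpace ℝ (Fin 3) →L[ℝ] ℝ).hasFDerivAt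
  have hS := (((hc 0).pow 2).add ((hc 1).pow 2)).sqrt h₁.ne'
  have hD := ((((hS.sub_const R).pow 2).add ((hc 2).pow 2)).sqrt h₂.ne').sub_const r
  rw [hasGradientAt_iff_hasFDerivAt]
  refine HasFDerivAt.congr_fderiv hD ?_
  ext v
  simp [PiLp.inner_apply, Fin.sum_univ_three, ← hs, ← hd]
  field_simp

/-- For `0 < r < R` and every `p ∈ Ω`: (i) `π(p)` lies on the torus
`𝒯 = {ρ = 0}`, i.e. `ρ(π(p)) = 0`; (ii) `‖p − π(p)‖ = |ρ(p)| = dist(p, 𝒯)`, so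
`π(p)` is a nearest point of `𝒯` to `p`; and (iii) `π(π(p)) = π(p)`. -/
theorem cpProj_props (R r : ℝ) (hr : 0 < r) (hrR : r < R)
    (p : EuclideanSpace ℝ (Fin 3)) (hp : p ∈ torusDom R) :
    torusSD R r (cpProj R r p) = 0 ∧
    ‖p - cpProj R r p‖ = |torusSD R r p| ∧
    |torusSD R r p| =
      Metric.infDist p {q : EuclideanSpace ℝ (Fin 3) | torusSD R r q = 0} ∧
    cpProj R r (cpProj R r p) = cpProj R r p := by
  obtain ⟨s, hs⟩ : ∃ s, s = Real.sqrt (p 0 ^ 2 + p 1 ^ 2) := ⟨_, rfl⟩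
  obtain ⟨d, hd⟩ : ∃ d, d = Real.sqrt ((s - R) ^ 2 + p 2 ^ 2) := ⟨_, rfl⟩
  have hgrad := (hasGradientAt_torusSD R r hp hs hd).gradient
  have hρ : torusSD R r p = d - r := by rw [torusSD, ← hs, ← hd]
  have hs0 : 0 < s := hs ▸ Real.sqrt_pos.2 hp.1
  have hd0 : 0 < d := by rw [hd, hs]; exact Real.sqrt_pos.2 hp.2
  have hs2 : s ^ 2 = p 0 ^ 2 + p 1 ^ 2 := by rw [hs, Real.sq_sqrt hp.1.le]
  have hd2 : d ^ 2 = (s - R) ^ 2 + p 2 ^ 2 := by rw [hd, Real.sq_sqrt (by positivity)]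
  have hunit : ‖gradient (torusSD R r) p‖ = 1 := by
    rw [hgrad, EuclideanSpace.norm_eq, Real.sqrt_eq_one, Fin.sum_univ_three]
    simp only [Real.norm_eq_abs, sq_abs, Matrix.cons_val]
    field_simp
    linear_combination -(s - R) ^ 2 * hs2 - s ^ 2 * hd2
  have hrad : 0 < R + r * ((s - R) / d) := by
    have : -1 ≤ (s - R) / d := by
      rw [le_div_iff₀ hd0]
      have : |s - R| ≤ d := abs_le_of_sq_le_sq (by nlinarith [sq_nonneg (p 2)]) hd0.le
      linarith [(abs_le.1 this).1]
    nlinarith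
  have h0 : cpProj R r p 0 = p 0 / s * (R + r * ((s - R) / d)) := by
    simp [cpProj, hgrad, hρ]; field_simp; ring
  have h1 : cpProj R r p 1 = p 1 / s * (R + r * ((s - R) / d)) := by
    simp [cpProj, hgrad, hρ]; field_simp; ring
  have h2 : cpProj R r p 2 = r * (p 2 / d) := by
    simp [cpProj, hgrad, hρ]; field_simp; ring
  have hmem : torusSD R r (cpProj R r p) = 0 := by
    have hs' : (cpProj R r p 0) ^ 2 + (cpProj R r p 1) ^ 2 = (R + r * ((s - R) / d)) ^ 2 := by
      have : (p 0 / s) ^ 2 + (p 1 / s) ^ 2 = 1 := by field_simp; exact hs2.symm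
      rw [h0, h1]
      linear_combination (R + r * ((s - R) / d)) ^ 2 * this
    have hd' : (R + r * ((s - R) / d) - R) ^ 2 + (r * (p 2 / d)) ^ 2 = r ^ 2 := by
      have : ((s - R) / d) ^ 2 + (p 2 / d) ^ 2 = 1 := by field_simp; exact hd2.symm
      linear_combination r ^ 2 * this
    rw [torusSD, hs', Real.sqrt_sq hrad.le, h2, hd', Real.sqrt_sq hr.le, sub_self]
  have hnorm : ‖p - cpProj R r p‖ = |torusSD R r p| := by
    rw [cpProj, sub_sub_cancel, norm_smul, hunit, mul_one, Real.norm_eq_abs]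
  refine ⟨hmem, hnorm, le_antisymm ?_ ?_, ?_⟩
  · refine (Metric.le_infDist ⟨cpProj R r p, hmem⟩).2 fun q hq => ?_
    have hlip := abs_torusSD_sub_le_dist R r p q
    rwa [show torusSD R r q = 0 from hq, sub_zero] at hlip
  · rw [← hnorm, ← dist_eq_norm]
    exact Metric.infDist_le_dist_of_mem hmem
  · conv_lhs => rw [cpProj, hmem, zero_smul, sub_zero]
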